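/- Let V_1 ⊆ V be a nonzero subspace and let T_1,…,T_N (N ≥ 0) be A-linear endomorphisms of ⋀V ⊗ A such that each T_i is either (i) left exterior multiplication u∧(−) by some u ∈ V⊗_k A, or (ii) the contraction ι_c for some c ∈ V^* with c|_{V_1} = 0. Then str_A(T_1∘T_2∘⋯∘T_N) = 0. -/

import Mathlib

open TensorProduct

/-- The supertrace `str_A(T) = tr_A(ε ∘ T)` of an `A`-linear endomorphism of `A ⊗ₖ ⋀V`,
where `ε` is the parity (grade) involution. -/
noncomputable def superTrace (k : Type*) [Field k] (A : Type*) [CommRing A] [Algebra k A]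
    (V : Type*) [AddCommGroup V] [Module k V]
    (T : (A ⊗[k] ExteriorAlgebra k V) →ₗ[A] (A ⊗[k] ExteriorAlgebra k V)) : A :=
  LinearMap.trace A (A ⊗[k] ExteriorAlgebra k V)
    ((LinearMap.baseChange A
        (CliffordAlgebra.involute (Q := (0 : QuadraticForm k V))).toLinearMap) ∘ₗ T)

/-- Left exterior multiplication by `u ∈ A ⊗ₖ V` on `A ⊗ₖ ⋀V`. -/
noncomputable def wedgeOp (k : Type*) [Field k] (A : Type*) [CommRing A] [Algebra k A]
    (V : Type*) [AddCommGroup V] [Module k V] (u : A ⊗[k] V) :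
    (A ⊗[k] ExteriorAlgebra k V) →ₗ[A] (A ⊗[k] ExteriorAlgebra k V) :=
  LinearMap.mulLeft A (LinearMap.baseChange A (ExteriorAlgebra.ι k (M := V)) u)

/-- The contraction `ι_c` by `c ∈ V^*`, base changed to `A ⊗ₖ ⋀V`. -/
noncomputable def contrOp (k : Type*) [Field k] (A : Type*) [CommRing A] [Algebra k A]
    (V : Type*) [AddCommGroup V] [Module k V] (c : Module.Dual k V) :
    (A ⊗[k] ExteriorAlgebra k V) →ₗ[A] (A ⊗[k] ExteriorAlgebra k V) :=
  LinearMap.baseChange A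
    (CliffordAlgebra.contractLeft (Q := (0 : QuadraticForm k V)) c)

/-- Let `τ` be a trace on a ring, `E` an idempotent (an even projection) and `W`, `F` elements with
`W` odd and `F * W + W * F = 1`. If all members of a list are odd and anticommute with `W`, the
supertrace of their product vanishes. -/
theorem trace_parity_mul_list_prod_eq_zero {R S : Type*} [Ring R] [AddCommGroup S] (τ : R →+ S)
    (hτ : ∀ x y, τ (x * y) = τ (y * x)) {E W F : R} (hE : E * E = E) (hEW : E * W = W * (1 - E))
    (hFW : F * W + W * F = 1) (l : List R)
    (hl : ∀ T ∈ l, E * T = T * (1 - E) ∧ W * T = -(T * W)) :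
    τ ((2 * E - 1) * l.prod) = 0 := by
  have parity : (E * l.prod = l.prod * E ∧ W * l.prod = l.prod * W) ∨
      (E * l.prod = l.prod * (1 - E) ∧ W * l.prod = -(l.prod * W)) := by
    induction l with
    | nil => simp
    | cons T l ih =>
      obtain ⟨hT, hT'⟩ := hl T (by simp)
      simp only [List.prod_cons, ← mul_assoc, hT, hT', neg_mul]
      simp only [mul_assoc, sub_mul, one_mul]
      rcases ih fun T hT => hl T (by simp [hT]) with ⟨h, h'⟩ | ⟨h, h'⟩
      · right
        simp [h, h', mul_sub]
      · left
        simp [h, h', mul_sub]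
  generalize l.prod = P at parity
  rcases parity with ⟨h, h'⟩ | ⟨h, h'⟩
  · have hεW : (2 * E - 1) * W = -(W * (2 * E - 1)) := by
      rw [sub_mul, mul_assoc, hEW]
      noncomm_ring
    have key : τ ((2 * E - 1) * P * (F * W)) = -τ ((2 * E - 1) * P * (W * F)) := by
      rw [← mul_assoc, hτ, ← mul_assoc, ← mul_assoc, ← neg_eq_iff_eq_neg.mpr hεW, neg_mul, neg_mul,
        map_neg, mul_assoc _ W P, h']
      simp only [mul_assoc]
    rw [← mul_one (_ * P), ← congrArg ((2 * E - 1) * P * ·) hFW]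
    simp only [mul_add, map_add, key, neg_add_cancel]
  · have h0 : τ (E * P) = 0 := by
      have : E * P = E * P * (1 - E) := by rw [mul_assoc, ← h, ← mul_assoc, hE]
      rw [this, hτ, ← mul_assoc, sub_mul, one_mul, hE, sub_self, zero_mul, map_zero]
    have h1 : P = E * P + P * E := by rw [h]; noncomm_ring
    have h2 : τ P = 0 := by rw [h1, map_add, hτ P E, h0, add_zero]
    rw [sub_mul, one_mul, mul_assoc, two_mul, map_sub, map_add, h0, h2]
    simp

namespace ExteriorAlgebra

variable {k : Type*} [Field k] {V : Type*} [AddCommGroup V] [Module k V]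

/-- The projection of the exterior algebra onto its even part. -/
noncomputable def evenProj (k : Type*) [Field k] (V : Type*) [AddCommGroup V] [Module k V] :
    Module.End k (ExteriorAlgebra k V) :=
  GradedAlgebra.proj (CliffordAlgebra.evenOdd (0 : QuadraticForm k V)) 0

theorem evenProj_algebraMap (r : k) :
    evenProj k V (algebraMap k _ r) = algebraMap k (ExteriorAlgebra k V) r := by
  rw [evenProj, GradedAlgebra.proj_apply]
  exact DirectSum.decompose_of_mem_same _
    (SetLike.algebraMap_mem_graded (CliffordAlgebra.evenOdd (0 : QuadraticForm k V)) r)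

theorem evenProj_ι_mul (v : V) (x : ExteriorAlgebra k V) :
    evenProj k V (ι k v * x) = ι k v * (x - evenProj k V x) := by
  have hv : ι k v ∈ CliffordAlgebra.evenOdd (0 : QuadraticForm k V) 1 :=
    CliffordAlgebra.ι_mem_evenOdd_one _ v
  classical
  have hsum : x = GradedAlgebra.proj (CliffordAlgebra.evenOdd (0 : QuadraticForm k V)) 0 x +
      GradedAlgebra.proj (CliffordAlgebra.evenOdd (0 : QuadraticForm k V)) 1 x := by
    conv_lhs => rw [← DirectSum.sum_support_decompose
      (CliffordAlgebra.evenOdd (0 : QuadraticForm k V)) x]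
    rw [Finset.sum_subset (Finset.subset_univ _) (fun i _ hi => by simpa using hi)]
    exact Fin.sum_univ_two _
  have hx : x - evenProj k V x =
      GradedAlgebra.proj (CliffordAlgebra.evenOdd (0 : QuadraticForm k V)) 1 x :=
    sub_eq_of_eq_add' hsum
  rw [hx, evenProj, GradedAlgebra.proj_apply, GradedAlgebra.proj_apply]
  exact DirectSum.coe_decompose_mul_add_of_left_mem
    (CliffordAlgebra.evenOdd (0 : QuadraticForm k V)) (i := 1) (j := 1) hv

theorem evenProj_mul_self : evenProj k V * evenProj k V = evenProj k V := by
  refine LinearMap.ext fun x => ?_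
  simp only [Module.End.mul_apply, evenProj, GradedAlgebra.proj_apply]
  exact congrArg Subtype.val (by rw [DirectSum.decompose_coe, DirectSum.of_eq_same])

theorem evenProj_mul_mulLeft (v : V) :
    evenProj k V * LinearMap.mulLeft k (ι k v) =
      LinearMap.mulLeft k (ι k v) * (1 - evenProj k V) := by
  exact LinearMap.ext fun x => evenProj_ι_mul v x

theorem evenProj_mul_contractLeft (c : Module.Dual k V) :
    evenProj k V * CliffordAlgebra.contractLeft (Q := (0 : QuadraticForm k V)) c =
      CliffordAlgebra.contractLeft (Q := (0 : QuadraticForm k V)) c * (1 - evenProj k V) := by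
  refine LinearMap.ext fun x => ?_
  simp only [Module.End.mul_apply, LinearMap.sub_apply, Module.End.one_apply]
  induction x using CliffordAlgebra.left_induction with
  | algebraMap r =>
    have h := evenProj_algebraMap (V := V) r
    erw [h]
    simp [CliffordAlgebra.contractLeft_algebraMap]
  | add x y hx hy => simp only [map_add, map_sub, hx, hy]; abel
  | ι_mul x v hx =>
    have h (y : ExteriorAlgebra k V) :
        evenProj k V (CliffordAlgebra.ι (0 : QuadraticForm k V) v * y) =
          CliffordAlgebra.ι (0 : QuadraticForm k V) v * (y - evenProj k V y) :=
      evenProj_ι_mul v y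
    have h' : CliffordAlgebra.ι (0 : QuadraticForm k V) v * x -
        CliffordAlgebra.ι (0 : QuadraticForm k V) v * (x - evenProj k V x) =
          CliffordAlgebra.ι (0 : QuadraticForm k V) v * evenProj k V x := by
      rw [← mul_sub, sub_sub_cancel]
    rw [CliffordAlgebra.contractLeft_ι_mul, map_sub, map_smul, h, hx, h, h',
      CliffordAlgebra.contractLeft_ι_mul, map_sub, sub_sub_cancel]

theorem involute_eq_two_mul_evenProj_sub_one :
    (CliffordAlgebra.involute (Q := (0 : QuadraticForm k V))).toLinearMap =
      2 * evenProj k V - 1 := by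
  refine LinearMap.ext fun x => ?_
  rw [two_mul]
  simp only [LinearMap.sub_apply, LinearMap.add_apply, Module.End.one_apply,
    AlgHom.toLinearMap_apply]
  induction x using CliffordAlgebra.left_induction with
  | algebraMap r =>
    have h := evenProj_algebraMap (V := V) r
    erw [h]
    rw [AlgHom.commutes, add_sub_cancel_right]
  | add x y hx hy => rw [map_add, map_add, hx, hy]; abel
  | ι_mul x v hx =>
    have h : evenProj k V (CliffordAlgebra.ι (0 : QuadraticForm k V) v * x) =
          CliffordAlgebra.ι (0 : QuadraticForm k V) v * (x - evenProj k V x) :=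
      evenProj_ι_mul v x
    rw [map_mul, CliffordAlgebra.involute_ι, hx, h]
    noncomm_ring

theorem contractLeft_mul_mulLeft (c : Module.Dual k V) (v : V) :
    CliffordAlgebra.contractLeft (Q := (0 : QuadraticForm k V)) c * LinearMap.mulLeft k (ι k v) +
      LinearMap.mulLeft k (ι k v) * CliffordAlgebra.contractLeft (Q := (0 : QuadraticForm k V)) c =
        c v • (1 : Module.End k (ExteriorAlgebra k V)) := by
  refine LinearMap.ext fun x => ?_
  have h := CliffordAlgebra.contractLeft_ι_mul (Q := (0 : QuadraticForm k V)) (d := c) v x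
  exact eq_sub_iff_add_eq.mp h

theorem mulLeft_ι_mul_mulLeft_ι (v w : V) :
    LinearMap.mulLeft k (ι k v) * LinearMap.mulLeft k (ι k w) =
      -(LinearMap.mulLeft k (ι k w) * LinearMap.mulLeft k (ι k v)) := by
  refine LinearMap.ext fun x => ?_
  simp only [Module.End.mul_apply, LinearMap.neg_apply, LinearMap.mulLeft_apply, ← mul_assoc]
  rw [eq_neg_iff_add_eq_zero, ← add_mul, ι_add_mul_swap, zero_mul]

end ExteriorAlgebra

theorem wedgeOp_add {k : Type*} [Field k] {A : Type*} [CommRing A] [Algebra k A]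
    {V : Type*} [AddCommGroup V] [Module k V] (u w : A ⊗[k] V) :
    wedgeOp k A V (u + w) = wedgeOp k A V u + wedgeOp k A V w := by
  ext x
  simp [wedgeOp, add_mul]

theorem wedgeOp_tmul {k : Type*} [Field k] {A : Type*} [CommRing A] [Algebra k A]
    {V : Type*} [AddCommGroup V] [Module k V] (a : A) (v : V) :
    wedgeOp k A V (a ⊗ₜ v) =
      a • LinearMap.baseChange A (LinearMap.mulLeft k (ExteriorAlgebra.ι k v)) := by
  ext x
  simp [wedgeOp, TensorProduct.smul_tmul']

theorem wedgeOp_odd_anticommute {k : Type*} [Field k] {A : Type*} [CommRing A] [Algebra k A]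
    {V : Type*} [AddCommGroup V] [Module k V] (e : V) (u : A ⊗[k] V) :
    (ExteriorAlgebra.evenProj k V).baseChange A * wedgeOp k A V u =
        wedgeOp k A V u * (1 - (ExteriorAlgebra.evenProj k V).baseChange A) ∧
      (LinearMap.mulLeft k (ExteriorAlgebra.ι k e)).baseChange A * wedgeOp k A V u =
        -(wedgeOp k A V u * (LinearMap.mulLeft k (ExteriorAlgebra.ι k e)).baseChange A) := by
  induction u with
  | zero =>
    have : wedgeOp k A V 0 = 0 := by ext x; simp [wedgeOp]
    simp [this]
  | add u w hu hw =>
    simp only [wedgeOp_add, mul_add, add_mul, hu.1, hu.2, hw.1, hw.2, neg_add, true_and]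
  | tmul a v =>
    have hE := congrArg (LinearMap.baseChange A) (ExteriorAlgebra.evenProj_mul_mulLeft (k := k) v)
    have hW := congrArg (LinearMap.baseChange A)
      (ExteriorAlgebra.mulLeft_ι_mul_mulLeft_ι (k := k) e v)
    rw [LinearMap.baseChange_mul, LinearMap.baseChange_mul, LinearMap.baseChange_sub,
      LinearMap.baseChange_one] at hE
    rw [LinearMap.baseChange_mul, LinearMap.baseChange_neg, LinearMap.baseChange_mul] at hW
    rw [wedgeOp_tmul, mul_smul_comm, smul_mul_assoc, mul_smul_comm, smul_mul_assoc, hE, hW]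
    refine ⟨rfl, ?_⟩
    module

theorem contrOp_odd_anticommute {k : Type*} [Field k] {A : Type*} [CommRing A] [Algebra k A]
    {V : Type*} [AddCommGroup V] [Module k V] {e : V} {c : Module.Dual k V} (hc : c e = 0) :
    (ExteriorAlgebra.evenProj k V).baseChange A * contrOp k A V c =
        contrOp k A V c * (1 - (ExteriorAlgebra.evenProj k V).baseChange A) ∧
      (LinearMap.mulLeft k (ExteriorAlgebra.ι k e)).baseChange A * contrOp k A V c =
        -(contrOp k A V c * (LinearMap.mulLeft k (ExteriorAlgebra.ι k e)).baseChange A) := by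
  have h := ExteriorAlgebra.contractLeft_mul_mulLeft c e
  rw [hc, zero_smul, add_comm, ← eq_neg_iff_add_eq_zero] at h
  rw [contrOp, ← LinearMap.baseChange_one, ← LinearMap.baseChange_sub]
  simp only [← LinearMap.baseChange_mul, ← LinearMap.baseChange_neg]
  rw [ExteriorAlgebra.evenProj_mul_contractLeft, h]
  exact ⟨rfl, rfl⟩

/-- if `V₁ ⊆ V` is a nonzero subspace and each `Tᵢ` is either left exterior
multiplication by some `u ∈ V ⊗ₖ A` or contraction by some `c ∈ V^*` vanishing on `V₁`, then
`str_A(T₁∘⋯∘T_N) = 0`. -/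
theorem stmt10 {k : Type*} [Field k] {V : Type*} [AddCommGroup V] [Module k V]
    [FiniteDimensional k V] {A : Type*} [CommRing A] [Algebra k A]
    (V1 : Submodule k V) (hV1 : V1 ≠ ⊥) (N : ℕ)
    (T : Fin N → ((A ⊗[k] ExteriorAlgebra k V) →ₗ[A] (A ⊗[k] ExteriorAlgebra k V)))
    (hT : ∀ i, (∃ u : A ⊗[k] V, T i = wedgeOp k A V u) ∨
      (∃ c : Module.Dual k V, (∀ v ∈ V1, c v = 0) ∧ T i = contrOp k A V c)) :
    superTrace k A V (List.ofFn T).prod = 0 := by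
  obtain ⟨e, he, he0⟩ := V1.exists_mem_ne_zero_of_ne_bot hV1
  obtain ⟨f, hf⟩ := Module.Projective.exists_dual_eq_one k he0
  have hFW := congrArg (LinearMap.baseChange A) (ExteriorAlgebra.contractLeft_mul_mulLeft f e)
  rw [hf, one_smul, LinearMap.baseChange_add, LinearMap.baseChange_mul, LinearMap.baseChange_mul,
    LinearMap.baseChange_one] at hFW
  have hE := congrArg (LinearMap.baseChange A) (ExteriorAlgebra.evenProj_mul_self (k := k) (V := V))
  rw [LinearMap.baseChange_mul] at hE
  have hEW := congrArg (LinearMap.baseChange A) (ExteriorAlgebra.evenProj_mul_mulLeft (k := k) e)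
  rw [LinearMap.baseChange_mul, LinearMap.baseChange_mul, LinearMap.baseChange_sub,
    LinearMap.baseChange_one] at hEW
  have hε := congrArg (LinearMap.baseChange A)
    (ExteriorAlgebra.involute_eq_two_mul_evenProj_sub_one (k := k) (V := V))
  rw [two_mul, LinearMap.baseChange_sub, LinearMap.baseChange_add, LinearMap.baseChange_one,
    ← two_mul] at hε
  rw [superTrace, hε]
  refine trace_parity_mul_list_prod_eq_zero
    (LinearMap.trace A (A ⊗[k] ExteriorAlgebra k V)).toAddMonoidHom
    (LinearMap.trace_mul_comm A) hE hEW hFW (List.ofFn T) fun S hS => ?_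
  obtain ⟨i, rfl⟩ := List.mem_ofFn.mp hS
  rcases hT i with ⟨u, hu⟩ | ⟨c, hc, hu⟩
  · rw [hu]
    exact wedgeOp_odd_anticommute e u
  · rw [hu]
    exact contrOp_odd_anticommute (hc e he)
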